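/- arXiv:1708.07390 — 2 statements merged into one kernel-verified Lean document; each statement's English description precedes it below -/
import Mathlib

section
/- Let r ≥ 2, let S = K[x_1,…,x_r], let p = ⟨x_1−x_2, x_2−x_3, …, x_{r−1}−x_r⟩, and let M be a finitely generated ℕ^r-graded S-module. Then rk_S(M) = rk_{S/p}(M ⊗_S S/p), where S/p ≅ K[x] is a polynomial ring in one variable and M ⊗_S S/p is viewed as an S/p-module. -/
set_option synthInstance.maxHeartbeats 1000000
set_option maxHeartbeats 1000000

/-- The rank of a module `M` over an integral domain `R`:
`rk_R(M) = dim_Q (M ⊗_R Q)` where `Q` is the fraction field of `R`. -/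
noncomputable def rk (R : Type) [CommRing R] (M : Type) [AddCommGroup M] [Module R M] : ℕ :=
  Module.finrank (FractionRing R) (TensorProduct R (FractionRing R) M)

/-!
STATEMENT 18: Let `r ≥ 2`, `S = K[x_1,…,x_r]`, `p = ⟨x_1−x_2, …, x_{r−1}−x_r⟩`
(the ideal generated by the consecutive differences of the variables), and let `M`
be a finitely generated ℕ^r-graded `S`-module.  Then
`rk_S(M) = rk_{S/p}(M ⊗_S S/p)`.
-/

open MvPolynomial DirectSum in
theorem proj_smul18 {K : Type} [Field K] {r : ℕ}
    {M : Type} [AddCommGroup M] [Module (MvPolynomial (Fin r) K) M]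
    [Module K M]
    (ℳ : (Fin r →₀ ℕ) → Submodule K M) [DirectSum.Decomposition ℳ]
    (hMgr : ∀ (u v : Fin r →₀ ℕ) (c : K) (m : M), m ∈ ℳ v →
      (MvPolynomial.monomial u c) • m ∈ ℳ (u + v))
    (u v : Fin r →₀ ℕ) (s : MvPolynomial (Fin r) K) (g : M) (hg : g ∈ ℳ v) :
    (decompose ℳ (s • g) (u + v) : M) = monomial u (coeff u s) • g := by
  induction s using MvPolynomial.induction_on' with
  | monomial a c =>
    have h := hMgr a v c g hg
    by_cases hau : a = u
    · subst hau
      rw [decompose_of_mem_same ℳ h]; simp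
    · rw [decompose_of_mem_ne ℳ h (fun e => hau (add_right_cancel e))]
      simp [coeff_monomial, hau]
  | add p q hp hq =>
    rw [add_smul, decompose_add, coeff_add, map_add, add_smul, ← hp, ← hq]
    rfl

open MvPolynomial DirectSum in
theorem exists_bound18 {K : Type} [Field K] {r : ℕ}
    {M : Type} [AddCommGroup M] [Module (MvPolynomial (Fin r) K) M]
    [Module K M] [Module.Finite (MvPolynomial (Fin r) K) M]
    (ℳ : (Fin r →₀ ℕ) → Submodule K M) [DirectSum.Decomposition ℳ] :
    ∃ d : Fin r →₀ ℕ, Submodule.span (MvPolynomial (Fin r) K)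
      {g : M | ∃ v, v ≤ d ∧ g ∈ ℳ v} = ⊤ := by
  classical
  obtain ⟨T, hT⟩ := (Module.Finite.fg_top : (⊤ : Submodule (MvPolynomial (Fin r) K) M).FG)
  refine ⟨∑ t ∈ T, ∑ v ∈ (decompose ℳ t).support, v, ?_⟩
  rw [eq_top_iff, ← hT, Submodule.span_le]
  intro t ht
  rw [← DirectSum.sum_support_decompose ℳ t]
  refine Submodule.sum_mem _ fun v hv => Submodule.subset_span ⟨v, ?_, SetLike.coe_mem _⟩
  refine le_trans ?_ (Finset.single_le_sum
    (f := fun t => ∑ v ∈ (decompose ℳ t).support, v) (fun _ _ => zero_le) ht)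
  exact Finset.single_le_sum (f := fun v : Fin r →₀ ℕ => v) (fun _ _ => zero_le) hv

open MvPolynomial DirectSum in
theorem surj18 {K : Type} [Field K] {r : ℕ}
    {M : Type} [AddCommGroup M] [Module (MvPolynomial (Fin r) K) M]
    [Module K M]
    (ℳ : (Fin r →₀ ℕ) → Submodule K M) [DirectSum.Decomposition ℳ]
    (hMgr : ∀ (u v : Fin r →₀ ℕ) (c : K) (m : M), m ∈ ℳ v →
      (MvPolynomial.monomial u c) • m ∈ ℳ (u + v))
    (d : Fin r →₀ ℕ) (hd : Submodule.span (MvPolynomial (Fin r) K)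
      {g : M | ∃ v, v ≤ d ∧ g ∈ ℳ v} = ⊤) (u : Fin r →₀ ℕ) (m : M) (hm : m ∈ ℳ (u + d)) :
    ∃ m' ∈ ℳ d, m = (monomial u (1 : K)) • m' := by
  have key : ∀ m : M, ∀ s : MvPolynomial (Fin r) K,
      ∃ m' ∈ ℳ d, (decompose ℳ (s • m) (u + d) : M) = (monomial u (1 : K)) • m' := by
    intro m
    have hm : m ∈ Submodule.span (MvPolynomial (Fin r) K)
      {g : M | ∃ v, v ≤ d ∧ g ∈ ℳ v} := hd ▸ Submodule.mem_top
    induction hm using Submodule.span_induction with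
    | mem g hg =>
      obtain ⟨v, hv, hg⟩ := hg
      intro s
      have e : u + d = (u + (d - v)) + v := by rw [add_assoc, tsub_add_cancel_of_le hv]
      refine ⟨monomial (d - v) (coeff (u + (d - v)) s) • g, ?_, ?_⟩
      · have := hMgr (d - v) v (coeff (u + (d - v)) s) g hg
        rwa [tsub_add_cancel_of_le hv] at this
      · rw [e, proj_smul18 ℳ hMgr _ _ _ _ hg, smul_smul, monomial_mul, one_mul]
    | zero => exact fun s => ⟨0, zero_mem _, by simp⟩
    | add x y _ _ hx hy =>
      intro s
      obtain ⟨a, ha, ha'⟩ := hx s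
      obtain ⟨b, hb, hb'⟩ := hy s
      refine ⟨a + b, add_mem ha hb, ?_⟩
      rw [smul_add, decompose_add, smul_add, ← ha', ← hb']
      rfl
    | smul a x _ hx =>
      intro s
      rw [smul_smul]
      exact hx _
  obtain ⟨m', h1, h2⟩ := key m 1
  rw [one_smul, decompose_of_mem_same ℳ hm] at h2
  exact ⟨m', h1, h2⟩

open MvPolynomial DirectSum in
theorem exists_free18 {K : Type} [Field K] {r : ℕ}
    {M : Type} [AddCommGroup M] [Module (MvPolynomial (Fin r) K) M]
    [Module K M] [IsScalarTower K (MvPolynomial (Fin r) K) M]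
    [Module.Finite (MvPolynomial (Fin r) K) M]
    (ℳ : (Fin r →₀ ℕ) → Submodule K M) [DirectSum.Decomposition ℳ]
    (hMgr : ∀ (u v : Fin r →₀ ℕ) (c : K) (m : M), m ∈ ℳ v →
      (MvPolynomial.monomial u c) • m ∈ ℳ (u + v)) :
    ∃ (ι : Type) (d : Fin r →₀ ℕ)
      (φ : (ι →₀ MvPolynomial (Fin r) K) →ₗ[MvPolynomial (Fin r) K] M)
      (ψ : M →ₗ[MvPolynomial (Fin r) K] (ι →₀ MvPolynomial (Fin r) K)),
      (∀ m, φ (ψ m) = monomial d (1 : K) • m) ∧ (∀ x, ψ (φ x) = monomial d (1 : K) • x) := by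
  classical
  obtain ⟨d0, hd0⟩ := exists_bound18 (K := K) ℳ
  have surj0 := surj18 ℳ hMgr d0 hd0
  -- stable kernel
  let ker : (Fin r →₀ ℕ) → Submodule (MvPolynomial (Fin r) K) M := fun u =>
    LinearMap.ker (LinearMap.lsmul (MvPolynomial (Fin r) K) M (monomial u (1 : K)))
  have hker : ∀ u m, m ∈ ker u ↔ monomial u (1 : K) • m = 0 := fun u m => by
    simp [ker]
  obtain ⟨_, ⟨u0, rfl⟩, hu0⟩ := set_has_maximal_iff_noetherian.mpr
    (inferInstance : IsNoetherian (MvPolynomial (Fin r) K) M) (Set.range ker) ⟨_, ⟨0, rfl⟩⟩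
  have stab : ∀ (u : Fin r →₀ ℕ) (m : M), monomial (u + u0) (1 : K) • m = 0 → monomial u0 (1 : K) • m = 0 := by
    intro u m h
    have hle : ker u0 ≤ ker (u + u0) := by
      intro m hm
      rw [hker] at hm ⊢
      rw [← one_mul (1 : K), ← monomial_mul, mul_smul, hm, smul_zero]
    have := eq_of_le_of_not_lt hle (hu0 _ ⟨_, rfl⟩)
    rw [← hker, this, hker]
    exact h
  have mm : ∀ (a b : Fin r →₀ ℕ) (m : M), monomial a (1 : K) • monomial b (1 : K) • m
      = monomial (a + b) (1 : K) • m := by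
    intro a b m
    rw [smul_smul, monomial_mul, one_mul]
  set d := u0 + d0 with hd
  have surj : ∀ u : Fin r →₀ ℕ, ∀ m ∈ ℳ (u + d), ∃ m' ∈ ℳ d, m = monomial u (1 : K) • m' := by
    intro u m hm
    rw [hd, ← add_assoc] at hm
    obtain ⟨m', h1, h2⟩ := surj0 _ m hm
    exact ⟨monomial u0 1 • m', hMgr _ _ _ _ h1, by rw [h2, mm]⟩
  have inj : ∀ u : Fin r →₀ ℕ, ∀ m ∈ ℳ d, monomial u (1 : K) • m = 0 → m = 0 := by
    intro u m hm h
    obtain ⟨m', h1, rfl⟩ := surj0 u0 m hm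
    rw [mm] at h
    exact stab u m' h
  let b := Module.Basis.ofVectorSpace K (ℳ d)
  let ι := Module.Basis.ofVectorSpaceIndex K (ℳ d)
  let φ : (ι →₀ MvPolynomial (Fin r) K) →ₗ[MvPolynomial (Fin r) K] M :=
    Finsupp.linearCombination _ (fun i => (b i : M))
  have hφ : Function.Injective φ := by
    rw [injective_iff_map_eq_zero]
    intro x hx
    have hsum : ∀ u, ∑ i ∈ x.support, coeff u (x i) • b i = 0 := by
      intro u
      have h1 : (decompose ℳ (φ x) (u + d) : M) =
          ∑ i ∈ x.support, monomial u (coeff u (x i)) • (b i : M) := by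
        simp only [φ, Finsupp.linearCombination_apply, Finsupp.sum]
        rw [decompose_sum, DFinsupp.finset_sum_apply, AddSubmonoidClass.coe_finset_sum]
        exact Finset.sum_congr rfl fun i _ => proj_smul18 ℳ hMgr _ _ _ _ (b i).2
      rw [hx, decompose_zero] at h1
      have h2 : monomial u (1 : K) • ((∑ i ∈ x.support, coeff u (x i) • b i : ℳ d) : M) = 0 := by
        rw [AddSubmonoidClass.coe_finset_sum, Finset.smul_sum]
        refine Eq.trans (Finset.sum_congr rfl fun i _ => ?_) h1.symm
        rw [Submodule.coe_smul, ← algebraMap_smul (MvPolynomial (Fin r) K) (coeff u (x i)) (b i : M),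
          smul_smul, algebraMap_eq, mul_comm, C_mul_monomial, mul_one]
      exact Subtype.ext (inj u _ (Subtype.mem _) h2)
    ext i u
    by_cases hi : i ∈ x.support
    · exact linearIndependent_iff'.mp b.linearIndependent _ _ (hsum u) i hi
    · simp [Finsupp.notMem_support_iff.mp hi]
  have hrange : ∀ m, monomial d (1 : K) • m ∈ LinearMap.range φ := by
    have hV : ∀ m ∈ ℳ d, m ∈ LinearMap.range φ := by
      intro m hm
      have h := b.linearCombination_repr ⟨m, hm⟩
      have h' := congrArg (Subtype.val) h
      simp only [Finsupp.linearCombination_apply, Finsupp.sum] at h'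
      rw [AddSubmonoidClass.coe_finset_sum] at h'
      change _ = m at h'
      rw [← h']
      refine Submodule.sum_mem _ fun i _ => ?_
      rw [Submodule.coe_smul, ← algebraMap_smul (MvPolynomial (Fin r) K) _ (b i : M)]
      refine Submodule.smul_mem _ _ ⟨Finsupp.single i 1, ?_⟩
      simp [φ]
    intro m
    rw [← DirectSum.sum_support_decompose ℳ m, Finset.smul_sum]
    refine Submodule.sum_mem _ fun v _ => ?_
    have := hMgr d v 1 _ (decompose ℳ m v).2
    rw [add_comm] at this
    obtain ⟨m', h1, h2⟩ := surj v _ this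
    rw [h2]
    exact Submodule.smul_mem _ _ (hV _ h1)
  let e := LinearEquiv.ofInjective φ hφ
  let ψ : M →ₗ[MvPolynomial (Fin r) K] (ι →₀ MvPolynomial (Fin r) K) :=
    e.symm.toLinearMap ∘ₗ LinearMap.codRestrict (LinearMap.range φ)
      (LinearMap.lsmul (MvPolynomial (Fin r) K) M (monomial d (1 : K))) hrange
  have h1 : ∀ m, φ (ψ m) = monomial d (1 : K) • m := by
    intro m
    have : e (ψ m) = ⟨monomial d (1 : K) • m, hrange m⟩ := e.apply_symm_apply _
    exact congrArg Subtype.val this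
  refine ⟨ι, d, φ, ψ, h1, fun x => hφ ?_⟩
  rw [h1, map_smul]

theorem finrank18 {S Q M F : Type} [CommRing S] [CommRing Q] [Nontrivial S] [Nontrivial Q]
    [Algebra S Q]
    [AddCommGroup M] [Module S M] [AddCommGroup F] [Module S F] [Module.Free S F] (f : S)
    (hf : IsUnit (algebraMap S Q f)) (φ : F →ₗ[S] M) (ψ : M →ₗ[S] F)
    (h1 : ∀ m, φ (ψ m) = f • m) (h2 : ∀ x, ψ (φ x) = f • x) :
    Module.finrank Q (TensorProduct S Q M) = Module.finrank S F := by
  have e1 : (φ.baseChange Q) ∘ₗ (ψ.baseChange Q) = algebraMap S Q f • LinearMap.id := by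
    ext m
    simp [h1, TensorProduct.tmul_smul]
  have e2 : (ψ.baseChange Q) ∘ₗ (φ.baseChange Q) = algebraMap S Q f • LinearMap.id := by
    ext m
    simp [h2, TensorProduct.tmul_smul]
  have hb : Function.Bijective (φ.baseChange Q) := by
    obtain ⟨a, ha⟩ := hf
    constructor
    · rw [injective_iff_map_eq_zero]
      intro x hx
      have := LinearMap.congr_fun e2 x
      rw [LinearMap.comp_apply, hx, map_zero, ← ha] at this
      exact ((smul_eq_zero_iff_eq a).mp this.symm)
    · intro y
      refine ⟨ψ.baseChange Q ((↑a⁻¹ : Q) • y), ?_⟩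
      have := LinearMap.congr_fun e1 ((↑a⁻¹ : Q) • y)
      rw [LinearMap.comp_apply] at this
      rw [this, ← ha, LinearMap.smul_apply, LinearMap.id_apply, smul_smul, Units.mul_inv, one_smul]
  rw [← (LinearEquiv.ofBijective _ hb).finrank_eq, Module.finrank_baseChange]

open MvPolynomial in
theorem ker18 {K : Type} [Field K] {r : ℕ} (hr : 2 ≤ r) (p : Ideal (MvPolynomial (Fin r) K))
    (hpdef : p = Ideal.span {f | ∃ i j : Fin r, (j : ℕ) = (i : ℕ) + 1 ∧
      f = MvPolynomial.X i - MvPolynomial.X j}) :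
    p = RingHom.ker (aeval (fun _ => Polynomial.X) : MvPolynomial (Fin r) K →ₐ[K] Polynomial K) := by
  apply le_antisymm
  · rw [hpdef, Ideal.span_le]
    rintro _ ⟨i, j, _, rfl⟩
    simp [RingHom.mem_ker]
  · have hX : ∀ (n : ℕ) (h : n < r), Ideal.Quotient.mk p (X ⟨n, h⟩) =
        Ideal.Quotient.mk p (X ⟨0, by omega⟩) := by
      intro n
      induction n with
      | zero => intro h; rfl
      | succ n ih =>
        intro h
        rw [← ih (by omega), eq_comm, Ideal.Quotient.eq, hpdef]
        exact Ideal.subset_span ⟨_, _, rfl, rfl⟩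
    have hc : (Polynomial.aeval (Ideal.Quotient.mkₐ K p (X ⟨0, by omega⟩))).comp
        (aeval (fun _ => Polynomial.X) : MvPolynomial (Fin r) K →ₐ[K] Polynomial K) =
        Ideal.Quotient.mkₐ K p := by
      ext i
      simpa using (hX i i.2).symm
    intro f hf
    have := AlgHom.congr_fun hc f
    rw [AlgHom.comp_apply, (RingHom.mem_ker).mp hf, map_zero] at this
    exact Ideal.Quotient.eq_zero_iff_mem.mp this.symm

theorem statement18 (K : Type) [Field K] (r : ℕ) (hr : 2 ≤ r)
    (M : Type) [AddCommGroup M] [Module (MvPolynomial (Fin r) K) M]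
    [Module K M] [IsScalarTower K (MvPolynomial (Fin r) K) M]
    [Module.Finite (MvPolynomial (Fin r) K) M]
    (ℳ : (Fin r →₀ ℕ) → Submodule K M)
    (hM : DirectSum.IsInternal ℳ)
    (hMgr : ∀ (u v : Fin r →₀ ℕ) (c : K) (m : M), m ∈ ℳ v →
      (MvPolynomial.monomial u c) • m ∈ ℳ (u + v))
    (p : Ideal (MvPolynomial (Fin r) K))
    (hpdef : p = Ideal.span {f | ∃ i j : Fin r, (j : ℕ) = (i : ℕ) + 1 ∧
      f = MvPolynomial.X i - MvPolynomial.X j}) :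
    rk (MvPolynomial (Fin r) K) M =
      rk (MvPolynomial (Fin r) K ⧸ p)
        (TensorProduct (MvPolynomial (Fin r) K) (MvPolynomial (Fin r) K ⧸ p) M) := by
  classical
  let _ := hM.chooseDecomposition
  obtain ⟨ι, d, φ, ψ, h1, h2⟩ := exists_free18 ℳ hMgr
  have hk := ker18 hr p hpdef
  haveI hp : p.IsPrime := by rw [hk]; exact RingHom.ker_isPrime _
  have hd : MvPolynomial.monomial d (1 : K) ∉ p := by
    rw [hk, RingHom.mem_ker]
    simp [MvPolynomial.aeval_monomial, Finsupp.prod, Finset.prod_eq_zero_iff]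
  unfold rk
  rw [finrank18 (Q := FractionRing (MvPolynomial (Fin r) K)) _ ?_ φ ψ h1 h2,
    (TensorProduct.AlgebraTensorModule.cancelBaseChange (MvPolynomial (Fin r) K)
      (MvPolynomial (Fin r) K ⧸ p) (FractionRing (MvPolynomial (Fin r) K ⧸ p))
      (FractionRing (MvPolynomial (Fin r) K ⧸ p)) M).finrank_eq,
    finrank18 (Q := FractionRing (MvPolynomial (Fin r) K ⧸ p)) _ ?_ φ ψ h1 h2]
  · rw [IsScalarTower.algebraMap_apply _ (MvPolynomial (Fin r) K ⧸ p), isUnit_iff_ne_zero, Ne,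
      FaithfulSMul.algebraMap_eq_zero_iff]
    exact fun h => hd (Ideal.Quotient.eq_zero_iff_mem.mp h)
  · rw [isUnit_iff_ne_zero, Ne, FaithfulSMul.algebraMap_eq_zero_iff]
    simp
end

section
/- (Hilbert Syzygy Theorem.) Every finitely generated module M over the polynomial ring S = K[x_1,…,x_r] has a free resolution of length at most r by finitely generated free S-modules; that is, there exists an exact sequence 0 → F_r → F_{r−1} → ⋯ → F_1 → F_0 → M → 0 of S-modules in which each F_i is a finitely generated free S-module (some of which may be zero). -/
open TensorProduct

def FR (R : Type) [CommRing R] : ℕ → ∀ (M : Type) [AddCommGroup M] [Module R M], Prop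
  | 0, M, _, _ => Module.Free R M ∧ Module.Finite R M
  | n+1, M, _, _ => ∃ (k : ℕ) (f : (Fin k → R) →ₗ[R] M), Function.Surjective f ∧
      FR R n (LinearMap.ker f)

section
variable {R : Type} [CommRing R]

lemma FR_equiv (n : ℕ) {M N : Type} [AddCommGroup M] [Module R M] [AddCommGroup N] [Module R N]
    (e : M ≃ₗ[R] N) (h : FR R n M) : FR R n N := by
  cases n with
  | zero =>
    obtain ⟨h1, h2⟩ := h
    exact ⟨Module.Free.of_equiv e, Module.Finite.equiv e⟩
  | succ n =>
    obtain ⟨k, f, hf, h⟩ := h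
    refine ⟨k, e.toLinearMap ∘ₗ f, e.surjective.comp hf, ?_⟩
    have : LinearMap.ker (e.toLinearMap ∘ₗ f) = LinearMap.ker f := by
      ext; simp
    rw [this]; exact h

lemma FR_succ (n : ℕ) {N F M : Type} [AddCommGroup M] [Module R M] [AddCommGroup N] [Module R N]
    [AddCommGroup F] [Module R F] [Module.Free R F] [Module.Finite R F]
    (i : N →ₗ[R] F) (p : F →ₗ[R] M) (hi : Function.Injective i) (hp : Function.Surjective p)
    (hex : Function.Exact i p) (h : FR R n N) : FR R (n+1) M := by
  obtain ⟨k, ⟨e⟩⟩ : ∃ k, Nonempty ((Fin k → R) ≃ₗ[R] F) := by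
    let b := Module.Free.chooseBasis R F
    exact ⟨_, ⟨(b.reindex (Fintype.equivFin _)).equivFun.symm⟩⟩
  refine ⟨k, p ∘ₗ e.toLinearMap, hp.comp e.surjective, ?_⟩
  refine FR_equiv n (LinearEquiv.ofBijective
    ((e.symm.toLinearMap ∘ₗ i).codRestrict (LinearMap.ker (p ∘ₗ e.toLinearMap)) ?_) ⟨?_, ?_⟩) h
  · intro c
    simp [hex.apply_apply_eq_zero]
  · intro a b hab
    apply hi
    simpa using congrArg Subtype.val hab
  · rintro ⟨x, hx⟩
    obtain ⟨y, hy⟩ := (hex (e x)).1 (by simpa using hx)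
    exact ⟨y, by ext1; simp [hy]⟩

lemma FR_mono (n : ℕ) : ∀ {M : Type} [AddCommGroup M] [Module R M], FR R n M → FR R (n+1) M := by
  induction n with
  | zero =>
    intro M _ _ h
    obtain ⟨h1, h2⟩ := h
    refine FR_succ 0 (0 : PUnit →ₗ[R] M) (LinearMap.id) (fun _ _ _ => rfl) (fun x => ⟨x, rfl⟩) ?_
      ⟨inferInstance, inferInstance⟩
    intro x; simp [eq_comm]
  | succ n ih =>
    rintro M _ _ ⟨k, f, hf, h⟩
    exact ⟨k, f, hf, ih h⟩

lemma FR_ext (n : ℕ) : ∀ {A B C : Type} [AddCommGroup A] [Module R A] [AddCommGroup B] [Module R B]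
    [AddCommGroup C] [Module R C] (i : A →ₗ[R] B) (p : B →ₗ[R] C), Function.Injective i →
    Function.Surjective p → Function.Exact i p → FR R n A → FR R n C → FR R n B := by
  induction n with
  | zero =>
    rintro A B C _ _ _ _ _ _ i p hi hp hex ⟨_, _⟩ ⟨_, _⟩
    obtain ⟨s, hs⟩ := Module.projective_lifting_property p LinearMap.id hp
    have hs' : ∀ c, p (s c) = c := fun c => LinearMap.congr_fun hs c
    have e : (A × C) ≃ₗ[R] B := LinearEquiv.ofBijective (i.coprod s) (by
      constructor
      · rw [injective_iff_map_eq_zero]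
        rintro ⟨a, c⟩ h
        have h' : i a + s c = 0 := by simpa using h
        have hc : c = 0 := by
          have := congrArg p h'
          simpa [hex.apply_apply_eq_zero, hs'] using this
        subst hc
        have : a = 0 := hi (by simpa using h')
        simp [this]
      · intro b
        obtain ⟨a, ha⟩ := (hex (b - s (p b))).1 (by simp [hs'])
        exact ⟨(a, p b), by simp [ha]⟩)
    exact ⟨Module.Free.of_equiv e, Module.Finite.equiv e⟩
  | succ n ih =>
    rintro A B C _ _ _ _ _ _ i p hi hp hex ⟨k, f, hf, h⟩ ⟨l, g, hg, h'⟩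
    obtain ⟨s, hs⟩ := Module.projective_lifting_property p g hp
    have hs' : ∀ c, p (s c) = g c := fun c => LinearMap.congr_fun hs c
    let q : ((Fin k → R) × (Fin l → R)) →ₗ[R] B := (i ∘ₗ f).coprod s
    have hq : ∀ x, q x = i (f x.1) + s x.2 := fun x => rfl
    refine FR_succ n (LinearMap.ker q).subtype q (Submodule.subtype_injective _) ?_
      (LinearMap.exact_subtype_ker_map q) ?_
    · intro b
      obtain ⟨c, hc⟩ := hg (p b)
      obtain ⟨a, ha⟩ := (hex (b - s c)).1 (by simp [hs', hc])
      obtain ⟨a', rfl⟩ := hf a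
      exact ⟨(a', c), by simp [hq, ha]⟩
    · refine ih (A := LinearMap.ker f) (C := LinearMap.ker g)
        ((LinearMap.inl R _ _ ∘ₗ (LinearMap.ker f).subtype).codRestrict _ ?_)
        ((LinearMap.snd R _ _ ∘ₗ (LinearMap.ker q).subtype).codRestrict _ ?_) ?_ ?_ ?_ h h'
      · rintro ⟨c, hc⟩
        have hc' : f c = 0 := hc
        simp [hq, hc']
      · rintro ⟨c, hc⟩
        have hc' : i (f c.1) + s c.2 = 0 := hc
        have := congrArg p hc'
        simpa [hex.apply_apply_eq_zero, hs'] using this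
      · intro a b hab
        have := congrArg Subtype.val hab
        simpa using this
      · rintro ⟨c, hc⟩
        have hc' : g c = 0 := hc
        obtain ⟨a, ha⟩ := (hex (s c)).1 (by simp [hs', hc'])
        obtain ⟨a', rfl⟩ := hf a
        refine ⟨⟨(-a', c), ?_⟩, ?_⟩
        · simp [hq, ha]
        · ext1; simp
      · rintro ⟨⟨x, y⟩, hc⟩
        have hc' : i (f x) + s y = 0 := hc
        constructor
        · intro h
          have hy : y = 0 := by simpa using congrArg Subtype.val h
          subst hy
          have : f x = 0 := hi (by simpa using hc')
          exact ⟨⟨x, this⟩, by ext1; simp⟩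
        · rintro ⟨z, hz⟩
          have := congrArg Subtype.val hz
          simp at this
          ext1; simp [← this.2]

lemma FR_cone (n : ℕ) {A B C : Type} [AddCommGroup A] [Module R A] [AddCommGroup B] [Module R B]
    [AddCommGroup C] [Module R C] (i : A →ₗ[R] B) (p : B →ₗ[R] C) (hi : Function.Injective i)
    (hp : Function.Surjective p) (hex : Function.Exact i p) (hA : FR R n A) (hB : FR R n B) :
    FR R (n+1) C := by
  cases n with
  | zero =>
    obtain ⟨_, _⟩ := hB
    exact FR_succ 0 i p hi hp hex hA
  | succ n =>
    obtain ⟨k, f, hf, h⟩ := hB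
    refine ⟨k, p ∘ₗ f, hp.comp hf, ?_⟩
    -- ker f → ker (p f) → A
    have key : ∀ x : LinearMap.ker (p ∘ₗ f), f x ∈ LinearMap.range i := fun x =>
      (hex (f x)).1 x.2
    let e := LinearEquiv.ofInjective i hi
    let π : LinearMap.ker (p ∘ₗ f) →ₗ[R] A :=
      e.symm.toLinearMap ∘ₗ (f ∘ₗ (LinearMap.ker (p ∘ₗ f)).subtype).codRestrict _ key
    have hπ : ∀ x, i (π x) = f x := fun x => by
      have : e (π x) = ⟨f x, key x⟩ := by simp [π]; rfl
      exact congrArg Subtype.val this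
    refine FR_ext (n+1) (A := LinearMap.ker f) (C := A)
      ((LinearMap.ker f).subtype.codRestrict _ ?_) π ?_ ?_ ?_ (FR_mono n h) hA
    · rintro ⟨x, hx⟩
      have : f x = 0 := hx
      simp [this]
    · intro a b hab
      have := congrArg Subtype.val hab
      simpa using this
    · intro a
      obtain ⟨x, hx⟩ := hf (i a)
      refine ⟨⟨x, by simp [hx, hex.apply_apply_eq_zero]⟩, hi ?_⟩
      rw [hπ]; exact hx
    · intro x
      constructor
      · intro h
        have : f x = 0 := by rw [← hπ, h, map_zero]
        exact ⟨⟨x, this⟩, by ext1; simp⟩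
      · rintro ⟨y, rfl⟩
        apply hi
        rw [hπ]
        simp

lemma FR_baseChange (S : Type) [CommRing S] [Algebra R S] [Module.Flat R S] (n : ℕ) :
    ∀ {M : Type} [AddCommGroup M] [Module R M], FR R n M → FR S n (S ⊗[R] M) := by
  induction n with
  | zero =>
    rintro M _ _ ⟨_, _⟩
    exact ⟨inferInstance, inferInstance⟩
  | succ n ih =>
    rintro M _ _ ⟨k, f, hf, h⟩
    refine FR_succ n ((LinearMap.ker f).subtype.baseChange S) (f.baseChange S) ?_ ?_ ?_ (ih h)
    · exact Module.Flat.lTensor_preserves_injective_linearMap _ (Submodule.subtype_injective _)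
    · exact LinearMap.lTensor_surjective S hf
    · exact lTensor_exact S (LinearMap.exact_subtype_ker_map f) hf

lemma FR_data (n : ℕ) : ∀ {M : Type} [AddCommGroup M] [Module R M], FR R n M →
    ∃ (k : ℕ → ℕ) (d : ∀ i : ℕ, (Fin (k (i + 1)) → R) →ₗ[R] (Fin (k i) → R))
      (ε : (Fin (k 0) → R) →ₗ[R] M),
      Function.Surjective ε ∧ Function.Exact (d 0) ε ∧
      (∀ i : ℕ, Function.Exact (d (i + 1)) (d i)) ∧ (∀ i : ℕ, n < i → k i = 0) := by
  induction n with
  | zero =>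
    rintro M _ _ ⟨_, _⟩
    obtain ⟨k, ⟨e⟩⟩ : ∃ k, Nonempty ((Fin k → R) ≃ₗ[R] M) := by
      let b := Module.Free.chooseBasis R M
      exact ⟨_, ⟨(b.reindex (Fintype.equivFin _)).equivFun.symm⟩⟩
    refine ⟨fun i => Nat.casesOn i k (fun _ => 0), fun i => 0, e.toLinearMap, e.surjective, ?_, ?_, ?_⟩
    · intro x
      have : e x = 0 ↔ x = 0 := map_eq_zero_iff e e.injective
      simp [eq_comm, ← this]
    · intro i x
      have : x = 0 := by ext j; exact j.elim0
      subst this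
      simp
    · intro i hi
      obtain ⟨j, rfl⟩ := Nat.exists_eq_succ_of_ne_zero hi.ne'
      rfl
  | succ n ih =>
    rintro M _ _ ⟨k, f, hf, h⟩
    obtain ⟨k', d', ε', h1, h2, h3, h4⟩ := ih h
    refine ⟨fun i => Nat.casesOn i k k', fun i => Nat.casesOn i ((LinearMap.ker f).subtype ∘ₗ ε') d',
      f, hf, ?_, ?_, ?_⟩
    · intro x
      constructor
      · intro hx
        obtain ⟨y, hy⟩ := h1 ⟨x, hx⟩
        exact ⟨y, by simp [hy]⟩
      · rintro ⟨y, rfl⟩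
        exact (ε' y).2
    · intro i
      cases i with
      | zero =>
        intro x
        rw [← show _ ↔ x ∈ Set.range (d' 0) from h2 x]
        simp
      | succ i => exact h3 i
    · intro i hi
      obtain ⟨j, rfl⟩ := Nat.exists_eq_succ_of_ne_zero (Nat.ne_zero_of_lt hi)
      exact h4 j (by omega)

end

section
open Polynomial
variable {A : Type} [CommRing A]

noncomputable def tcoef (L : Type) [AddCommGroup L] [Module A L] : (A[X] ⊗[A] L) ≃ₗ[A] (ℕ →₀ L) :=
  (TensorProduct.congr (Polynomial.basisMonomials A).repr (LinearEquiv.refl A L)) ≪≫ₗ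
    TensorProduct.finsuppScalarLeft A L ℕ

lemma tcoef_tmul {L : Type} [AddCommGroup L] [Module A L] (p : A[X]) (l : L) (n : ℕ) :
    tcoef L (p ⊗ₜ[A] l) n = p.coeff n • l := by
  have : (Polynomial.basisMonomials A).repr p n = p.coeff n := rfl
  simp [tcoef, TensorProduct.finsuppScalarLeft_apply_tmul_apply, this]

lemma tcoef_X_smul {L : Type} [AddCommGroup L] [Module A L] (z : A[X] ⊗[A] L) (n : ℕ) :
    tcoef L ((X : A[X]) • z) (n+1) = tcoef L z n := by
  induction z with
  | zero => simp
  | tmul p l => rw [TensorProduct.smul_tmul', tcoef_tmul, tcoef_tmul]; simp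
  | add x y hx hy => rw [smul_add, map_add (tcoef L), Finsupp.add_apply, hx, hy, map_add (tcoef L), Finsupp.add_apply]

lemma tcoef_baseChange {L L' : Type} [AddCommGroup L] [Module A L] [AddCommGroup L'] [Module A L']
    (f : L →ₗ[A] L') (z : A[X] ⊗[A] L) (n : ℕ) :
    tcoef L' (f.baseChange A[X] z) n = f (tcoef L z n) := by
  induction z with
  | zero => simp
  | tmul p l => rw [LinearMap.baseChange_tmul, tcoef_tmul, tcoef_tmul]; simp
  | add x y hx hy => rw [map_add, map_add, map_add, Finsupp.add_apply, Finsupp.add_apply, hx, hy, map_add]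

lemma phi_inj {L L' : Type} [AddCommGroup L] [Module A L] [AddCommGroup L'] [Module A L']
    (i t : L →ₗ[A] L') (hi : Function.Injective i) :
    Function.Injective ((X : A[X]) • i.baseChange A[X] - t.baseChange A[X]) := by
  rw [injective_iff_map_eq_zero]
  intro z hz
  have h1 : (X : A[X]) • i.baseChange A[X] z = t.baseChange A[X] z := by
    simpa [sub_eq_zero] using hz
  have h2 : ∀ n, i (tcoef L z n) = t (tcoef L z (n+1)) := fun n => by
    rw [← tcoef_baseChange, ← tcoef_baseChange, ← h1, tcoef_X_smul]
  have h3 : ∃ N, ∀ n, N ≤ n → tcoef L z n = 0 := by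
    refine ⟨(tcoef L z).support.sup id + 1, fun n hn => ?_⟩
    by_contra h
    have := Finset.le_sup (f := id) (Finsupp.mem_support_iff.2 h)
    simp only [id] at this
    omega
  obtain ⟨N, hN⟩ := h3
  have h4 : ∀ k n, N ≤ n + k → tcoef L z n = 0 := by
    intro k
    induction k with
    | zero => intro n hn; exact hN n hn
    | succ k ih =>
      intro n hn
      apply hi
      rw [h2, ih (n+1) (by omega), map_zero, map_zero]
  have : tcoef L z = 0 := by
    ext n; exact h4 N n (by omega)
  simpa using this

/-- polynomials vectors of degree at most `d` -/
noncomputable def DD (A : Type) [CommRing A] (m d : ℕ) : Submodule A (Fin m → A[X]) :=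
  Submodule.span A (Set.range (fun ij : Fin (d+1) × Fin m =>
    ((X : A[X]) ^ (ij.1 : ℕ)) • (Pi.single ij.2 1 : Fin m → A[X])))

lemma DD_mem (m d i : ℕ) (j : Fin m) (h : i ≤ d) :
    ((X : A[X]) ^ i) • (Pi.single j 1 : Fin m → A[X]) ∈ DD A m d :=
  Submodule.subset_span ⟨(⟨i, by omega⟩, j), rfl⟩

lemma DD_le (m : ℕ) {d d' : ℕ} (h : d ≤ d') : DD A m d ≤ DD A m d' := by
  unfold DD
  rw [Submodule.span_le]
  rintro _ ⟨⟨i, j⟩, rfl⟩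
  exact DD_mem m d' i j (by omega)

lemma DD_X (m d : ℕ) {v : Fin m → A[X]} (h : v ∈ DD A m d) : (X : A[X]) • v ∈ DD A m (d+1) := by
  unfold DD at h
  induction h using Submodule.span_induction with
  | mem x h =>
    obtain ⟨⟨i, j⟩, rfl⟩ := h
    simp only [smul_smul, ← pow_succ']
    exact DD_mem m (d+1) (i+1) j (by omega)
  | zero => simp
  | add x y _ _ hx hy => rw [smul_add]; exact add_mem hx hy
  | smul a x _ hx => rw [smul_comm]; exact Submodule.smul_mem _ _ hx

lemma DD_exists (m : ℕ) (v : Fin m → A[X]) : ∃ d, v ∈ DD A m d := by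
  refine ⟨Finset.univ.sup fun j => (v j).natDegree, ?_⟩
  suffices key : ∑ j, v j • (Pi.single j 1 : Fin m → A[X]) ∈
      DD A m (Finset.univ.sup fun j => (v j).natDegree) by
    rwa [← pi_eq_sum_univ' v] at key
  refine Submodule.sum_mem _ fun j _ => ?_
  have : (v j) • (Pi.single j 1 : Fin m → A[X]) = ∑ i ∈ Finset.range ((v j).natDegree + 1),
      (v j).coeff i • ((X : A[X]) ^ i • (Pi.single j 1 : Fin m → A[X])) := by
    conv_lhs => rw [(v j).as_sum_range_C_mul_X_pow]
    rw [Finset.sum_smul]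
    refine Finset.sum_congr rfl fun i _ => ?_
    rw [mul_smul]
    ext1 k
    simp [Polynomial.smul_eq_C_mul]
  rw [this]
  refine Submodule.sum_mem _ fun i hi => Submodule.smul_mem _ _ (DD_mem _ _ _ _ ?_)
  have := Finset.le_sup (f := fun j => (v j).natDegree) (Finset.mem_univ j)
  simp at hi this
  omega

lemma DD_finset (m : ℕ) (s : Finset (Fin m → A[X])) : ∃ d, ∀ v ∈ s, v ∈ DD A m d := by
  choose f hf using DD_exists (A := A) m
  exact ⟨s.sup f, fun v hv => DD_le m (Finset.le_sup hv) (hf v)⟩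

lemma FR_poly [IsNoetherianRing A] (n : ℕ)
    (H : ∀ (M : Type) [AddCommGroup M] [Module A M] [Module.Finite A M], FR A n M)
    (M : Type) [AddCommGroup M] [Module A[X] M] [Module.Finite A[X] M] : FR A[X] (n+1) M := by
  let _ : Module A M := Module.compHom M (algebraMap A A[X])
  have : IsScalarTower A A[X] M := IsScalarTower.of_algebraMap_smul fun _ _ => rfl
  obtain ⟨m, g, hg⟩ := Module.Finite.exists_fin' A[X] M
  obtain ⟨s, hs⟩ := (IsNoetherian.noetherian (LinearMap.ker g))
  obtain ⟨d, hd⟩ := DD_finset m s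
  let gA : (Fin m → A[X]) →ₗ[A] M := g.restrictScalars A
  have hgA : ∀ v, gA v = g v := fun _ => rfl
  let L : ℕ → Submodule A M := fun e => (DD A m e).map gA
  have hfin : ∀ e, Module.Finite A (L e) := fun e => by
    have : (DD A m e).FG := Submodule.fg_span (Set.finite_range _)
    exact Module.Finite.iff_fg.2 (this.map gA)
  have hLe : L d ≤ L (d+1) := Submodule.map_mono (DD_le m (by omega))
  have hLX : ∀ x ∈ L d, (X : A[X]) • x ∈ L (d+1) := by
    rintro _ ⟨v, hv, rfl⟩
    exact ⟨X • v, DD_X m d hv, by simp [hgA]⟩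
  let i : L d →ₗ[A] L (d+1) := Submodule.inclusion hLe
  let t : L d →ₗ[A] L (d+1) :=
    { toFun := fun x => ⟨(X : A[X]) • (x : M), hLX x x.2⟩
      map_add' := fun x y => by ext1; simp
      map_smul' := fun a x => by ext1; exact smul_comm (X : A[X]) a (x : M) }
  let φ : (A[X] ⊗[A] L d) →ₗ[A[X]] (A[X] ⊗[A] L (d+1)) :=
    (X : A[X]) • i.baseChange A[X] - t.baseChange A[X]
  have hφ1 : ∀ x, φ (1 ⊗ₜ x) = (X : A[X]) • (1 ⊗ₜ i x) - 1 ⊗ₜ t x := fun x => by simp [φ]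
  let p : (A[X] ⊗[A] L (d+1)) →ₗ[A[X]] M :=
    LinearMap.liftBaseChange A[X] (L (d+1)).subtype
  have hp1 : ∀ x : L (d+1), p (1 ⊗ₜ x) = x := fun x => by simp [p]
  have hmem : ∀ v ∈ DD A m (d+1), g v ∈ L (d+1) := fun v hv => ⟨v, hv, rfl⟩
  -- the section
  let Q := (A[X] ⊗[A] L (d+1)) ⧸ LinearMap.range φ
  let π : (A[X] ⊗[A] L (d+1)) →ₗ[A[X]] Q := (LinearMap.range φ).mkQ
  have hπ : ∀ x : L d, (X : A[X]) • π (1 ⊗ₜ i x) = π (1 ⊗ₜ t x) := fun x => by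
    rw [← sub_eq_zero, ← map_smul, ← map_sub, ← hφ1]
    exact (Submodule.Quotient.mk_eq_zero _).2 ⟨_, rfl⟩
  have he : ∀ j : Fin m, g (Pi.single j 1) ∈ L (d+1) := fun j =>
    hmem _ (by simpa using DD_mem (A := A) m (d+1) 0 j (by omega))
  let ψ : (Fin m → A[X]) →ₗ[A[X]] Q :=
    (Pi.basisFun A[X] (Fin m)).constr ℕ (fun j => π (1 ⊗ₜ ⟨g (Pi.single j 1), he j⟩))
  have hψ : ∀ j, ψ (Pi.single j 1) = π (1 ⊗ₜ ⟨g (Pi.single j 1), he j⟩) := fun j => by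
    have := (Pi.basisFun A[X] (Fin m)).constr_basis ℕ
      (fun j => π (1 ⊗ₜ ⟨g (Pi.single j 1), he j⟩)) j
    rwa [Pi.basisFun_apply] at this
  have hψ2 : ∀ (e : ℕ) (j : Fin m) (h : e ≤ d+1), ψ ((X : A[X])^e • Pi.single j 1) =
      π (1 ⊗ₜ ⟨g ((X : A[X])^e • Pi.single j 1), hmem _ (DD_mem m (d+1) e j h)⟩) := by
    intro e j
    induction e with
    | zero => intro h; simpa using hψ j
    | succ e ih =>
      intro h
      have h0 : ((X : A[X])^(e+1) • Pi.single j 1 : Fin m → A[X]) =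
        (X : A[X]) • ((X : A[X])^e • Pi.single j 1) := by rw [pow_succ', mul_smul]
      have h0' : ψ ((X : A[X])^(e+1) • Pi.single j 1) =
        (X : A[X]) • ψ ((X : A[X])^e • Pi.single j 1) := by rw [h0, map_smul]
      rw [h0', ih (by omega)]
      have hx : g ((X : A[X])^e • Pi.single j 1) ∈ L d := ⟨_, DD_mem m d e j (by omega), rfl⟩
      refine (hπ ⟨_, hx⟩).trans ?_
      congr 2
      ext1
      have : g ((X : A[X])^(e+1) • Pi.single j 1) =
        (X : A[X]) • g ((X : A[X])^e • Pi.single j 1) := by rw [h0, map_smul]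
      exact this.symm
  have hψ3 : ∀ (v : Fin m → A[X]) (hv : v ∈ DD A m (d+1)), ψ v = π (1 ⊗ₜ ⟨g v, hmem v hv⟩) := by
    let ψ' : DD A m (d+1) →ₗ[A] Q := ψ.restrictScalars A ∘ₗ (DD A m (d+1)).subtype
    let ρ : DD A m (d+1) →ₗ[A] Q := π.restrictScalars A ∘ₗ (TensorProduct.mk A A[X] (L (d+1)) 1) ∘ₗ
      gA.restrict hmem
    intro v hv
    have hv0 := hv
    unfold DD at hv0
    induction hv0 using Submodule.span_induction with
    | mem x h =>
      obtain ⟨⟨i, j⟩, rfl⟩ := h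
      exact hψ2 i j (by omega)
    | zero =>
      have := ρ.map_zero
      rw [map_zero]; exact this.symm
    | add x y hx hy hx' hy' =>
      rw [map_add, hx' hx, hy' hy]
      exact (ρ.map_add ⟨x, hx⟩ ⟨y, hy⟩).symm
    | smul a x hx hx' =>
      have h1 : ψ (a • x) = a • ψ x := (ψ.restrictScalars A).map_smul a x
      rw [h1, hx' hx]
      exact (ρ.map_smul a ⟨x, hx⟩).symm
  have hker : LinearMap.ker g ≤ LinearMap.ker ψ := by
    rw [← hs, Submodule.span_le]
    intro v hv
    have hgv : g v = 0 := by
      have : v ∈ LinearMap.ker g := hs ▸ Submodule.subset_span hv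
      exact this
    have hv' := DD_le m (Nat.le_succ d) (hd v hv)
    show ψ v = 0
    rw [hψ3 v hv']
    have : (⟨g v, hmem v hv'⟩ : L (d+1)) = 0 := by ext1; exact hgv
    rw [this, TensorProduct.tmul_zero, map_zero]
  -- descend
  have hdesc : ∀ z : A[X] ⊗[A] L (d+1), ∃ v, g v = p z ∧ ψ v = π z := by
    intro z
    induction z with
    | zero => exact ⟨0, by simp, by simp⟩
    | tmul q l =>
      obtain ⟨l, v, hv, rfl⟩ := l
      refine ⟨q • v, ?_, ?_⟩
      · simp [p, hgA]
      · rw [map_smul, hψ3 v hv, ← map_smul, TensorProduct.smul_tmul', smul_eq_mul, mul_one]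
        rfl
    | add x y hx hy =>
      obtain ⟨v, h1, h2⟩ := hx
      obtain ⟨w, h3, h4⟩ := hy
      exact ⟨v + w, by simp [h1, h3], by simp [h2, h4]⟩
  refine FR_cone n φ p (phi_inj i t (Submodule.inclusion_injective hLe)) ?_ ?_
    (FR_baseChange A[X] n (H (L d))) (FR_baseChange A[X] n (H (L (d+1))))
  · intro x
    obtain ⟨v, rfl⟩ := hg x
    refine ⟨∑ j, v j • (1 ⊗ₜ ⟨g (Pi.single j 1), he j⟩), ?_⟩
    rw [map_sum]
    simp only [map_smul, hp1]
    conv_rhs => rw [pi_eq_sum_univ' v, map_sum]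
    simp only [map_smul]
  · intro z
    constructor
    · intro hz
      obtain ⟨v, h1, h2⟩ := hdesc z
      have : ψ v = 0 := hker (show g v = 0 by rw [h1, hz])
      rw [this] at h2
      exact (Submodule.Quotient.mk_eq_zero _).1 h2.symm
    · rintro ⟨y, rfl⟩
      have : p ∘ₗ φ = 0 := by
        ext x
        simp [hφ1, hp1, i, t]
      exact LinearMap.congr_fun this y

lemma FR_transfer {R S : Type} [CommRing R] [CommRing S] (e : R ≃+* S) (n : ℕ)
    (H : ∀ (M : Type) [AddCommGroup M] [Module R M] [Module.Finite R M], FR R n M)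
    (M : Type) [AddCommGroup M] [Module S M] [Module.Finite S M] : FR S n M := by
  let _ : Algebra R S := e.toRingHom.toAlgebra
  let _ : Module R M := Module.compHom M (algebraMap R S)
  have : IsScalarTower R S M := IsScalarTower.of_algebraMap_smul fun _ _ => rfl
  have hsurj : Function.Surjective (algebraMap R S) := e.surjective
  let e' : R ≃ₗ[R] S := LinearEquiv.ofBijective (Algebra.linearMap R S) e.bijective
  have : Module.Free R S := Module.Free.of_equiv e'
  have : Module.Finite R S := Module.Finite.equiv e'
  have : Module.Finite R M := Module.Finite.trans S M
  let p : (S ⊗[R] M) →ₗ[S] M := LinearMap.liftBaseChange S LinearMap.id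
  have hp1 : ∀ x : M, p (1 ⊗ₜ x) = x := fun x => by simp [p]
  have h1 : ∀ z : S ⊗[R] M, ∃ x : M, z = 1 ⊗ₜ x := by
    intro z
    induction z with
    | zero => exact ⟨0, by simp⟩
    | tmul s l =>
      obtain ⟨r, rfl⟩ := hsurj s
      exact ⟨r • l, by rw [← TensorProduct.smul_tmul, Algebra.algebraMap_eq_smul_one]⟩
    | add x y hx hy =>
      obtain ⟨v, rfl⟩ := hx
      obtain ⟨w, rfl⟩ := hy
      exact ⟨v + w, by rw [TensorProduct.tmul_add]⟩
  refine FR_equiv n (LinearEquiv.ofBijective p ⟨?_, fun x => ⟨_, hp1 x⟩⟩) (FR_baseChange S n (H M))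
  intro a b hab
  obtain ⟨x, rfl⟩ := h1 a
  obtain ⟨y, rfl⟩ := h1 b
  rw [hp1, hp1] at hab
  rw [hab]

lemma FR_mv (K : Type) [Field K] (r : ℕ) : ∀ (M : Type) [AddCommGroup M]
    [Module (MvPolynomial (Fin r) K) M] [Module.Finite (MvPolynomial (Fin r) K) M],
    FR (MvPolynomial (Fin r) K) r M := by
  induction r with
  | zero =>
    exact FR_transfer (MvPolynomial.isEmptyAlgEquiv K (Fin 0)).symm.toRingEquiv 0
      (fun M _ _ _ => ⟨inferInstance, inferInstance⟩)
  | succ r ih =>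
    exact FR_transfer (MvPolynomial.finSuccEquiv K r).symm.toRingEquiv (r+1) (FR_poly r ih)

end


/-!
STATEMENT 19 (Hilbert Syzygy Theorem): Every finitely generated module `M` over
`S = K[x_1,…,x_r]` has a free resolution `0 → F_r → ⋯ → F_1 → F_0 → M → 0` of length
at most `r` by finitely generated free `S`-modules.  The resolution is encoded as an
ℕ-indexed complex with `F_i = (Fin (k i) → S)` (a finitely generated free `S`-module
of rank `k i`), exact everywhere, with `k i = 0` (i.e. `F_i = 0`) for `i > r`.
-/

theorem statement19 (K : Type) [Field K] (r : ℕ)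
    (M : Type) [AddCommGroup M] [Module (MvPolynomial (Fin r) K) M]
    [Module.Finite (MvPolynomial (Fin r) K) M] :
    ∃ (k : ℕ → ℕ)
      (d : ∀ i : ℕ, (Fin (k (i + 1)) → MvPolynomial (Fin r) K)
        →ₗ[MvPolynomial (Fin r) K] (Fin (k i) → MvPolynomial (Fin r) K))
      (ε : (Fin (k 0) → MvPolynomial (Fin r) K) →ₗ[MvPolynomial (Fin r) K] M),
      Function.Surjective ε ∧
      Function.Exact (d 0) ε ∧
      (∀ i : ℕ, Function.Exact (d (i + 1)) (d i)) ∧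
      (∀ i : ℕ, r < i → k i = 0) := by
  exact FR_data r (FR_mv K r M)
end
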